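/- (Lemma 1, first part.) Let φ(t) = max(1 − t, 0) be the hinge loss, K^E the Epanechnikov kernel, and b > 0. Then the first derivative φ_b′ of the convolution-smoothed hinge loss φ_b(t) = ∫_ℝ φ(t + b v) K^E(v) dv is Lipschitz continuous with Lipschitz constant c_b^E = 3/(4b): for all u₁, u₂ ∈ ℝ, |φ_b′(u₁) − φ_b′(u₂)| ≤ (3/(4b))·|u₁ − u₂|. -/

import Mathlib

open MeasureTheory

/-- The hinge loss `φ(t) = max(1 − t, 0)`. -/
noncomputable def hinge (t : ℝ) : ℝ := max (1 - t) 0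

/-- The Epanechnikov kernel `K^E(u) = (3/4)(1 − u²)` for `|u| ≤ 1`, and `0` otherwise. -/
noncomputable def epan (u : ℝ) : ℝ := if |u| ≤ 1 then (3 / 4) * (1 - u ^ 2) else 0

/-- The convolution-smoothed hinge loss `φ_b(t) = ∫ φ(t + b v) K(v) dv`. -/
noncomputable def smoothedHinge (K : ℝ → ℝ) (b t : ℝ) : ℝ :=
  ∫ v : ℝ, hinge (t + b * v) * K v

theorem epan_eq_max (u : ℝ) : epan u = 3 / 4 * max (1 - u ^ 2) 0 := by
  unfold epan
  split_ifs with h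
  · rw [max_eq_left]
    linarith [(sq_le_one_iff_abs_le_one u).2 h]
  · rw [max_eq_right, mul_zero]
    linarith [not_le.1 (mt (sq_le_one_iff_abs_le_one u).1 h)]

theorem continuous_epan : Continuous epan := by
  rw [funext epan_eq_max]
  fun_prop

theorem continuous_hinge : Continuous hinge := by
  unfold hinge
  fun_prop

theorem epan_nonneg (u : ℝ) : 0 ≤ epan u := by
  rw [epan_eq_max]
  positivity

theorem epan_le (u : ℝ) : epan u ≤ 3 / 4 := by
  rw [epan_eq_max]
  have : max (1 - u ^ 2) 0 ≤ 1 := max_le (by nlinarith [sq_nonneg u]) zero_le_one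
  linarith

theorem hasCompactSupport_epan : HasCompactSupport epan :=
  HasCompactSupport.intro (isCompact_Icc (a := (-1 : ℝ)) (b := 1)) fun _ hx =>
    if_neg fun h => hx (abs_le.1 h)

theorem integrable_epan : Integrable epan :=
  continuous_epan.integrable_of_hasCompactSupport hasCompactSupport_epan

theorem abs_hinge_sub_le (s t : ℝ) : |hinge s - hinge t| ≤ |s - t| := by
  have h := abs_max_sub_max_le_abs (1 - s) (1 - t) 0
  rwa [sub_sub_sub_cancel_left, abs_sub_comm t s] at h

theorem hasDerivAt_hinge {t : ℝ} (ht : t ≠ 1) :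
    HasDerivAt hinge (if t < 1 then -1 else 0) t := by
  rcases lt_or_gt_of_ne ht with h | h
  · rw [if_pos h]
    refine ((hasDerivAt_id t).const_sub 1).congr_of_eventuallyEq ?_
    filter_upwards [Iio_mem_nhds h] with s hs
    exact max_eq_left (sub_nonneg.2 (le_of_lt hs))
  · rw [if_neg h.not_gt]
    refine (hasDerivAt_const t (0 : ℝ)).congr_of_eventuallyEq ?_
    filter_upwards [Ioi_mem_nhds h] with s hs
    exact max_eq_right (sub_nonpos.2 (le_of_lt hs))

/-- The derivative of the smoothed hinge loss is minus the distribution function of the kernel,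
evaluated at `(1 - t) / b`. -/
theorem hasDerivAt_smoothedHinge_epan {b : ℝ} (hb : 0 < b) (t : ℝ) :
    HasDerivAt (smoothedHinge epan b) (-∫ u in Set.Iic ((1 - t) / b), epan u) t := by
  have hcont (s : ℝ) : Continuous fun v => hinge (s + b * v) * epan v :=
    (continuous_hinge.comp (by fun_prop)).mul continuous_epan
  have key := (hasDerivAt_integral_of_dominated_loc_of_lip (μ := volume)
    (F := fun s v => hinge (s + b * v) * epan v)
    (F' := (Set.Iio ((1 - t) / b)).indicator fun v => -epan v)
    (x₀ := t) (s := Set.univ) (bound := epan) Filter.univ_mem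
    (.of_forall fun s => (hcont s).aestronglyMeasurable)
    ((hcont t).integrable_of_hasCompactSupport hasCompactSupport_epan.mul_left)
    (continuous_epan.neg.aestronglyMeasurable.indicator measurableSet_Iio)
    (.of_forall fun v => ?_) integrable_epan ?_).2
  · rw [integral_indicator measurableSet_Iio, integral_neg, ← integral_Iic_eq_integral_Iio] at key
    exact key
  · refine LipschitzOnWith.of_dist_le_mul fun x _ y _ => ?_
    rw [Real.dist_eq, Real.dist_eq, ← sub_mul, abs_mul, mul_comm, Real.coe_nnabs]
    refine mul_le_mul_of_nonneg_left ?_ (abs_nonneg _)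
    simpa using abs_hinge_sub_le (x + b * v) (y + b * v)
  · filter_upwards [Measure.ae_ne volume ((1 - t) / b)] with v hv
    have hne : t + b * v ≠ 1 := fun h => hv (by rw [eq_div_iff hb.ne']; linarith)
    have hiff : t + b * v < 1 ↔ v < (1 - t) / b := by
      rw [lt_div_iff₀ hb]
      constructor <;> intro h <;> linarith
    have h := ((hasDerivAt_hinge hne).comp_add_const t (b * v)).mul_const (epan v)
    have hF : (Set.Iio ((1 - t) / b)).indicator (fun v => -epan v) v =
        (if t + b * v < 1 then -1 else 0) * epan v := by
      simp [Set.indicator_apply, hiff]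
    rw [hF]
    exact h

/-- Lemma 1 (first part): the first derivative of the Epanechnikov convolution-smoothed
hinge loss is Lipschitz continuous with constant `c_b^E = 3/(4b)`. -/
theorem smoothedHinge_epan_deriv_lipschitz (b : ℝ) (hb : 0 < b) :
    ∀ u₁ u₂ : ℝ,
      |deriv (smoothedHinge epan b) u₁ - deriv (smoothedHinge epan b) u₂| ≤
        3 / (4 * b) * |u₁ - u₂| := by
  intro u₁ u₂
  rw [(hasDerivAt_smoothedHinge_epan hb u₁).deriv, (hasDerivAt_smoothedHinge_epan hb u₂).deriv,
    neg_sub_neg, intervalIntegral.integral_Iic_sub_Iic integrable_epan.integrableOn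
      integrable_epan.integrableOn]
  refine (intervalIntegral.norm_integral_le_of_norm_le_const (f := epan) (C := 3 / 4)
    fun x _ => ?_).trans_eq ?_
  · rw [Real.norm_of_nonneg (epan_nonneg x)]
    exact epan_le x
  · rw [← sub_div, sub_sub_sub_cancel_left, abs_div, abs_of_pos hb]
    field_simp
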